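/- Let Σ = (x̃,ρ,B̃) be an acyclic generalized seed ordered so that b_{ij} ≥ 0 whenever n ≥ i > j ≥ 1, and fix i ∈ [1,n]. Writing B̃^{(k)} = μ_k⋯μ_1(B̃) with entries b^{(k)}_{st}, and x_j^{(j)} for the j-th cluster variable of Σ^{(j)} = μ_j⋯μ_1(Σ), one has ∏_{k=1}^{i−1} x_k^{−b_{ki}} · x_i^{(i)} = x'_i · ∏_{j ∈ [n+1,m], b^{(i−1)}_{ji} < 0} ( x_j^{−[b_{ji}]_+} ∏_{k ∈ [1,i−1], b^{(k−1)}_{jk} < 0} x_j^{b^{(k−1)}_{ki} b^{(k−1)}_{jk}} ) + f for some f ∈ ℤℙ[x_1, …, x_n, x_1^{(1)}, …, x_{i−1}^{(i−1)}], where x'_i is the cluster variable obtained by mutating the initial seed Σ once in direction i. -/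

import Mathlib

open Finset

namespace GCA

/-- Ambient field: the field of rational functions `ℚ(x₁,…,x_m)`. -/
abbrev K (m : ℕ) : Type := FractionRing (MvPolynomial (Fin m) ℚ)

/-- The variables `x₁,…,x_m` inside the ambient field. -/
noncomputable def xv (m : ℕ) (j : Fin m) : K m :=
  algebraMap (MvPolynomial (Fin m) ℚ) (K m) (MvPolynomial.X j)

/-- The coefficient ring `ℤℙ`: the Laurent polynomial ring generated over `ℤ`
by the frozen variables `x_{n+1},…,x_m` and their inverses, as a subalgebra of `K m`. -/
noncomputable def ZP (m n : ℕ) : Subalgebra ℤ (K m) :=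
  Algebra.adjoin ℤ {y | ∃ j : Fin m, n ≤ (j : ℕ) ∧ (y = xv m j ∨ y = (xv m j)⁻¹)}

/-- A (generalized) seed datum: the extended cluster, strings, and the exchange matrix. -/
structure Seed (m n : ℕ) where
  x : Fin m → K m
  ρ : Fin n → ℕ → K m
  B : Matrix (Fin m) (Fin n) ℤ

variable {m n : ℕ}

/-- The exponent `⌊[rβ]₊⌋ + ⌊[−(d−r)β]₊⌋` where `β = b/d`. -/
def mutExp (d : ℕ) (b : ℤ) (r : ℕ) : ℤ :=
  ⌊max ((r : ℚ) * b / d) 0⌋ + ⌊max (-(((d : ℚ) - r) * b / d)) 0⌋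

/-- Matrix mutation in direction `i` of an `m × n` exchange matrix. -/
def matMut (hmn : n ≤ m) (i : Fin n) (B : Matrix (Fin m) (Fin n) ℤ) :
    Matrix (Fin m) (Fin n) ℤ := fun k l =>
  if k = Fin.castLE hmn i ∨ l = i then -B k l
  else B k l + (|B k i| * B (Fin.castLE hmn i) l + B k i * |B (Fin.castLE hmn i) l|) / 2

/-- The exchanged cluster variable `x'_i` of a seed. -/
noncomputable def exchangeVar (hmn : n ≤ m) (d : Fin n → ℕ) (S : Seed m n) (i : Fin n) :
    K m :=
  (S.x (Fin.castLE hmn i))⁻¹ *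
    ∑ r ∈ Finset.range (d i + 1),
      S.ρ i r * ∏ k : Fin m, S.x k ^ mutExp (d i) (S.B k i) r

/-- Seed mutation in direction `i`. -/
noncomputable def Seed.mut (hmn : n ≤ m) (d : Fin n → ℕ) (i : Fin n) (S : Seed m n) :
    Seed m n where
  x := fun j => if j = Fin.castLE hmn i then exchangeVar hmn d S i else S.x j
  ρ := fun j r => if j = i then S.ρ i (d i - r) else S.ρ j r
  B := matMut hmn i S.B

/-- Apply a finite sequence of mutations (left-most applied first). -/
noncomputable def mutSeq (hmn : n ≤ m) (d : Fin n → ℕ) : List (Fin n) → Seed m n → Seed m n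
  | [], S => S
  | i :: l, S => mutSeq hmn d l (Seed.mut hmn d i S)

/-- `seedUpTo hmn d S k = μ_k ⋯ μ_2 μ_1 (S)` (paper's direction `t ∈ [1,n]` is Lean's `t-1`). -/
noncomputable def seedUpTo (hmn : n ≤ m) (d : Fin n → ℕ) (S : Seed m n) : ℕ → Seed m n
  | 0 => S
  | k + 1 => if h : k < n then Seed.mut hmn d ⟨k, h⟩ (seedUpTo hmn d S k) else seedUpTo hmn d S k

/-- The initial seed whose cluster variables are the canonical variables of `ℚ(x₁,…,x_m)`. -/
noncomputable def initSeed (m n : ℕ) (ρ : Fin n → ℕ → K m) (B : Matrix (Fin m) (Fin n) ℤ) :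
    Seed m n := ⟨xv m, ρ, B⟩

/-- The principal part of `B` is skew-symmetrizable. -/
def SkewSymmetrizable (hmn : n ≤ m) (B : Matrix (Fin m) (Fin n) ℤ) : Prop :=
  ∃ D : Fin n → ℤ, (∀ i, 0 < D i) ∧
    ∀ i j : Fin n, D i * B (Fin.castLE hmn i) j = -(D j * B (Fin.castLE hmn j) i)

/-- `p` is a monomial in `ℤ[x_{n+1},…,x_m]`. -/
def IsFrozenMonomial (m n : ℕ) (p : K m) : Prop :=
  ∃ (c : ℤ) (e : Fin m → ℕ), (∀ j : Fin m, (j : ℕ) < n → e j = 0) ∧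
    p = (c : K m) * ∏ j : Fin m, xv m j ^ e j

/-- The defining conditions on the datum `(d, ρ, B)` of a generalized seed of geometric type. -/
structure SeedHyps (m n : ℕ) (hmn : n ≤ m) (d : Fin n → ℕ) (ρ : Fin n → ℕ → K m)
    (B : Matrix (Fin m) (Fin n) ℤ) : Prop where
  d_pos : ∀ i, 0 < d i
  d_dvd : ∀ i j : Fin n, (d i : ℤ) ∣ B (Fin.castLE hmn j) i
  skew : SkewSymmetrizable hmn B
  rho_zero : ∀ i, ρ i 0 = 1
  rho_top : ∀ i, ρ i (d i) = 1
  rho_mon : ∀ i r, r ≤ d i → IsFrozenMonomial m n (ρ i r)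

/-- The edge relation of the directed graph `Γ`: an edge from `i` to `j` iff `b_{ij} > 0`. -/
def GammaEdge (hmn : n ≤ m) (B : Matrix (Fin m) (Fin n) ℤ) (i j : Fin n) : Prop :=
  0 < B (Fin.castLE hmn i) j

/-- The directed graph `Γ` has no oriented cycle. -/
def Acyclic (hmn : n ≤ m) (B : Matrix (Fin m) (Fin n) ℤ) : Prop :=
  ∀ i : Fin n, ¬ Relation.TransGen (GammaEdge hmn B) i i

/-- The ordering normalization: `b_{ij} ≥ 0` whenever `n ≥ i > j ≥ 1`. -/
def Ordered (hmn : n ≤ m) (B : Matrix (Fin m) (Fin n) ℤ) : Prop :=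
  ∀ i j : Fin n, j < i → 0 ≤ B (Fin.castLE hmn i) j

/-- Divisibility inside a subset `R` of the ambient field. -/
def DvdIn (R : Set (K m)) (p u : K m) : Prop := ∃ z ∈ R, u = p * z

/-- `u` and `v` are coprime in `R`: every common divisor in `R` is a unit of `R`. -/
def CoprimeIn (R : Set (K m)) (u v : K m) : Prop :=
  ∀ p ∈ R, DvdIn R p u → DvdIn R p v → ∃ q ∈ R, p * q = 1

/-- The polynomial ring `ℤℙ[x₁,…,x_n]` as a subalgebra of `K m`. -/
noncomputable def polyRing (hmn : n ≤ m) : Subalgebra ℤ (K m) :=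
  Algebra.adjoin ℤ
    ({y | ∃ j : Fin m, n ≤ (j : ℕ) ∧ (y = xv m j ∨ y = (xv m j)⁻¹)} ∪
      {y | ∃ j : Fin n, y = xv m (Fin.castLE hmn j)})

/-- The seed is coprime: the exchange polynomials `x_i x'_i` are pairwise coprime
in `ℤℙ[x₁,…,x_n]`. -/
def CoprimeSeed (hmn : n ≤ m) (d : Fin n → ℕ) (S : Seed m n) : Prop :=
  ∀ i j : Fin n, i ≠ j →
    CoprimeIn (↑(polyRing hmn (m := m)) : Set (K m))
      (S.x (Fin.castLE hmn i) * exchangeVar hmn d S i)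
      (S.x (Fin.castLE hmn j) * exchangeVar hmn d S j)

/-- All cluster variables of all seeds mutation-equivalent to `S`. -/
noncomputable def clusterVars (hmn : n ≤ m) (d : Fin n → ℕ) (S : Seed m n) : Set (K m) :=
  {y | ∃ (L : List (Fin n)) (i : Fin n), y = (mutSeq hmn d L S).x (Fin.castLE hmn i)}

/-- The generalized cluster algebra `𝒜(x̃,ρ,B̃)` as a `ℤℙ`-subalgebra of `ℚ(x₁,…,x_m)`. -/
noncomputable def gca (hmn : n ≤ m) (d : Fin n → ℕ) (S : Seed m n) :
    Subalgebra (↥(ZP m n)) (K m) :=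
  Algebra.adjoin (↥(ZP m n)) (clusterVars hmn d S)

/-- The generalized projective cluster variable `x_i^{(n)}`. -/
noncomputable def projVar (hmn : n ≤ m) (d : Fin n → ℕ) (S : Seed m n) (i : Fin n) : K m :=
  (seedUpTo hmn d S n).x (Fin.castLE hmn i)

/-- The lower bound generalized cluster algebra
`ℒ^{(n)}(Σ) = ℤℙ[x₁, x₁^{(n)}, …, x_n, x_n^{(n)}]`. -/
noncomputable def lowerBound (hmn : n ≤ m) (d : Fin n → ℕ) (S : Seed m n) :
    Subalgebra (↥(ZP m n)) (K m) :=
  Algebra.adjoin (↥(ZP m n))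
    ({y | ∃ i : Fin n, y = S.x (Fin.castLE hmn i)} ∪
      {y | ∃ i : Fin n, y = projVar hmn d S i})

/-- Index type for standard monomials: exponent pairs with no product `x_i x'_i`. -/
def StdIdx (n : ℕ) : Type := {v : Fin n → ℕ × ℕ // ∀ i, (v i).1 = 0 ∨ (v i).2 = 0}

/-- The (projective) standard monomial attached to an exponent vector. -/
noncomputable def stdMon (x x' : Fin n → K m) (v : StdIdx n) : K m :=
  ∏ i : Fin n, x i ^ (v.1 i).1 * x' i ^ (v.1 i).2

/-- Lexicographic order on exponent vectors. -/
def lexLt (a b : Fin n → ℤ) : Prop :=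
  ∃ k : Fin n, a k < b k ∧ ∀ j : Fin n, j < k → a j = b j

/-- The Laurent monomial `x^a = x₁^{a₁} ⋯ x_n^{a_n}`. -/
noncomputable def xpow (hmn : n ≤ m) (a : Fin n → ℤ) : K m :=
  ∏ i : Fin n, xv m (Fin.castLE hmn i) ^ a i

/-- `x^a` is the first Laurent monomial of `Y` (with some nonzero leading
coefficient in `ℤℙ`): `Y = c_a x^a + Σ_v c_v x^v` with all `v ≺ a`. -/
def IsFirstMonomial (hmn : n ≤ m) (Y : K m) (a : Fin n → ℤ) : Prop :=
  ∃ (s : Finset (Fin n → ℤ)) (c : (Fin n → ℤ) → K m),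
    (∀ v, c v ∈ ZP m n) ∧ c a ≠ 0 ∧ (∀ v ∈ s, lexLt v a) ∧
    Y = c a * xpow hmn a + ∑ v ∈ s, c v * xpow hmn v

end GCA


namespace GCA

theorem mutExp_pos (d g r : ℕ) (hd : 0 < d) (hr : r ≤ d) :
    mutExp d ((d : ℤ) * g) r = ((r * g : ℕ) : ℤ) := by
  have hd' : (d : ℚ) ≠ 0 := by positivity
  have hr' : (r : ℚ) ≤ d := by exact_mod_cast hr
  unfold mutExp
  have h1 : ((r : ℚ) * ((d : ℤ) * (g : ℤ) : ℤ) / d) = ((r * g : ℕ) : ℤ) := by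
    push_cast; field_simp
  have h2 : (-(((d : ℚ) - r) * ((d : ℤ) * (g : ℤ) : ℤ) / d)) ≤ 0 := by
    have : (((d : ℚ) - r) * ((d : ℤ) * (g : ℤ) : ℤ) / d) = (d - r) * g := by
      push_cast; field_simp
    rw [this]
    have : (0 : ℚ) ≤ (d - r) * g := mul_nonneg (by linarith) (by positivity)
    linarith
  rw [max_eq_right h2, h1, max_eq_left (by positivity), Int.floor_intCast]
  simp

theorem mutExp_neg (d g r : ℕ) (hd : 0 < d) (hr : r ≤ d) :
    mutExp d (-((d : ℤ) * g)) r = (((d - r) * g : ℕ) : ℤ) := by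
  have hd' : (d : ℚ) ≠ 0 := by positivity
  unfold mutExp
  have h1 : (-(((d : ℚ) - r) * ((-((d : ℤ) * (g : ℤ)) : ℤ)) / d)) = (((d - r) * g : ℕ) : ℤ) := by
    push_cast [Nat.cast_sub hr]; field_simp
  have h2 : ((r : ℚ) * (-((d : ℤ) * (g : ℤ)) : ℤ) / d) ≤ 0 := by
    have : ((r : ℚ) * (-((d : ℤ) * (g : ℤ)) : ℤ) / d) = - (r * g) := by
      push_cast; field_simp
    rw [this]
    have : (0 : ℚ) ≤ r * g := by positivity
    linarith
  rw [max_eq_right h2, h1, max_eq_left (by positivity), Int.floor_intCast]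
  simp

theorem mutExp_of_nonneg (d r : ℕ) (b : ℤ) (hb : 0 ≤ b) (hr : r ≤ d) :
    mutExp d b r = ⌊(r : ℚ) * b / d⌋ := by
  have hr' : (0 : ℚ) ≤ d - r := by
    have : (r : ℚ) ≤ d := by exact_mod_cast hr
    linarith
  have hb' : (0 : ℚ) ≤ b := by exact_mod_cast hb
  unfold mutExp
  rw [max_eq_left (by positivity), max_eq_right]
  · simp
  · have : 0 ≤ ((d : ℚ) - r) * b / d := by positivity
    linarith

theorem mutExp_of_nonpos (d r : ℕ) (b : ℤ) (hb : b ≤ 0) (hr : r ≤ d) :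
    mutExp d b r = ⌊-(((d : ℚ) - r) * b / d)⌋ := by
  have hr' : (0 : ℚ) ≤ d - r := by
    have : (r : ℚ) ≤ d := by exact_mod_cast hr
    linarith
  have hb' : (0 : ℚ) ≤ -b := by exact_mod_cast (by omega : 0 ≤ -b)
  unfold mutExp
  rw [max_eq_right, max_eq_left]
  · simp
  · have : 0 ≤ ((d : ℚ) - r) * (-b) / d := by positivity
    have h : -(((d : ℚ) - r) * b / d) = ((d : ℚ) - r) * (-b) / d := by ring
    rw [h]; exact this
  · have : 0 ≤ (r : ℚ) * (-b) / d := by positivity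
    have h : (r : ℚ) * (-b) / d = - ((r : ℚ) * b / d) := by ring
    linarith

theorem mutExp_shift (d r : ℕ) (b e : ℤ) (hd : 0 < d) (he : 0 ≤ e) (hr : r ≤ d) :
    mutExp d (b - d * e) r + r * e =
      mutExp d b r + if b - d * e < 0 then -(max b 0) + d * e else 0 := by
  have hd' : (d : ℚ) ≠ 0 := by positivity
  have hde : 0 ≤ (d : ℤ) * e := by positivity
  split_ifs with hc
  · rw [mutExp_of_nonpos _ _ _ hc.le hr]
    have h0 : (-(((d : ℚ) - r) * ((b - d * e : ℤ) : ℚ) / d)) =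
        (-(((d : ℚ) - r) * b / d)) + ((d - r) * e : ℤ) := by
      push_cast; field_simp; ring
    rw [h0, Int.floor_add_intCast]
    rcases le_total b 0 with hb | hb
    · rw [mutExp_of_nonpos _ _ _ hb hr, max_eq_right hb]; ring
    · rw [mutExp_of_nonneg _ _ _ hb hr, max_eq_left hb]
      have h1 : (-(((d : ℚ) - r) * b / d)) = (r : ℚ) * b / d - (b : ℤ) := by
        field_simp; ring
      rw [h1, Int.floor_sub_intCast]; ring
  · rw [mutExp_of_nonneg _ _ _ (by omega) hr, mutExp_of_nonneg _ _ _ (by omega) hr]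
    have h0 : ((r : ℚ) * ((b - d * e : ℤ) : ℚ) / d) = (r : ℚ) * b / d - (r * e : ℤ) := by
      push_cast; field_simp
    rw [h0, Int.floor_sub_intCast]; ring

theorem mutExp_zero_right (d : ℕ) (b : ℤ) (hd : 0 < d) : mutExp d b 0 = max (-b) 0 := by
  have hd' : (d : ℚ) ≠ 0 := by positivity
  rcases le_total b 0 with hb | hb
  · rw [mutExp_of_nonpos _ _ _ hb (by simp), max_eq_left (by omega)]
    have : (-(((d : ℚ) - (0 : ℕ)) * b / d)) = ((-b : ℤ) : ℚ) := by
      push_cast; field_simp; ring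
    rw [this, Int.floor_intCast]
  · rw [mutExp_of_nonneg _ _ _ hb (by simp), max_eq_right (by omega)]
    simp

/-- Congruence modulo `x R` inside a field. -/
def Cg {F : Type*} [Field F] (R : Subring F) (x a b : F) : Prop :=
  a ∈ R ∧ b ∈ R ∧ ∃ z ∈ R, a - b = x * z

namespace Cg
variable {F : Type*} [Field F] {R : Subring F} {x a b c e : F}

theorem refl (ha : a ∈ R) : Cg R x a a := ⟨ha, ha, 0, R.zero_mem, by simp⟩

theorem mul (h : Cg R x a b) (h' : Cg R x c e) : Cg R x (a * c) (b * e) := by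
  obtain ⟨ha, hb, z, hz, h⟩ := h
  obtain ⟨hc, he, w, hw, h'⟩ := h'
  refine ⟨R.mul_mem ha hc, R.mul_mem hb he, z * c + b * w,
    R.add_mem (R.mul_mem hz hc) (R.mul_mem hb hw), ?_⟩
  linear_combination c * h + b * h'

theorem add (h : Cg R x a b) (h' : Cg R x c e) : Cg R x (a + c) (b + e) := by
  obtain ⟨ha, hb, z, hz, h⟩ := h
  obtain ⟨hc, he, w, hw, h'⟩ := h'
  refine ⟨R.add_mem ha hc, R.add_mem hb he, z + w, R.add_mem hz hw, ?_⟩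
  linear_combination h + h'

theorem pow (h : Cg R x a b) (k : ℕ) : Cg R x (a ^ k) (b ^ k) := by
  induction k with
  | zero => simpa using refl R.one_mem
  | succ k ih => rw [pow_succ, pow_succ]; exact ih.mul h

theorem prod {ι : Type*} (s : Finset ι) (f g : ι → F) (h : ∀ i ∈ s, Cg R x (f i) (g i)) :
    Cg R x (∏ i ∈ s, f i) (∏ i ∈ s, g i) := by
  classical
  induction s using Finset.induction_on with
  | empty => simpa using refl R.one_mem
  | insert a s ha ih =>
    rw [Finset.prod_insert ha, Finset.prod_insert ha]
    exact (h _ (by simp)).mul (ih fun i hi => h i (by simp [hi]))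

theorem sum {ι : Type*} (s : Finset ι) (f g : ι → F) (h : ∀ i ∈ s, Cg R x (f i) (g i)) :
    Cg R x (∑ i ∈ s, f i) (∑ i ∈ s, g i) := by
  classical
  induction s using Finset.induction_on with
  | empty => simpa using refl R.zero_mem
  | insert a s ha ih =>
    rw [Finset.sum_insert ha, Finset.sum_insert ha]
    exact (h _ (by simp)).add (ih fun i hi => h i (by simp [hi]))

end Cg

theorem prod_split (hmn : n ≤ m) {M : Type*} [CommMonoid M] (F : Fin m → M) :
    ∏ l : Fin m, F l = (∏ l : Fin n, F (Fin.castLE hmn l)) *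
      ∏ j ∈ Finset.univ.filter (fun j : Fin m => n ≤ (j : ℕ)), F j := by
  classical
  rw [← Finset.prod_filter_mul_prod_filter_not Finset.univ (fun j : Fin m => (j : ℕ) < n)]
  congr 1
  · symm
    refine Finset.prod_bij (fun l _ => Fin.castLE hmn l) ?_ ?_ ?_ ?_
    · intro a _; simp
    · intro a _ b _ h; exact Fin.castLE_injective hmn h
    · intro b hb
      simp only [Finset.mem_filter, Finset.mem_univ, true_and] at hb
      exact ⟨⟨b, hb⟩, by simp, by ext; simp⟩
    · intro a _; rfl
  · apply Finset.prod_congr _ (fun _ _ => rfl)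
    ext j; simp

section
variable (hmn : n ≤ m) (d : Fin n → ℕ) (S : Seed m n)

theorem seedUpTo_succ (k : Fin n) :
    seedUpTo hmn d S ((k : ℕ) + 1) = Seed.mut hmn d k (seedUpTo hmn d S k) := by
  simp [seedUpTo]

theorem x_ge (k : ℕ) (j : Fin m) (h : k ≤ (j : ℕ)) : (seedUpTo hmn d S k).x j = S.x j := by
  induction k with
  | zero => rfl
  | succ k ih =>
    rw [seedUpTo]
    split_ifs with hk
    · have : j ≠ Fin.castLE hmn ⟨k, hk⟩ := by
        intro h'; rw [h'] at h; simp at h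
      simp only [Seed.mut, this, if_false]
      exact ih (by omega)
    · exact ih (by omega)

theorem x_frozen (k : ℕ) (j : Fin m) (h : n ≤ (j : ℕ)) : (seedUpTo hmn d S k).x j = S.x j := by
  induction k with
  | zero => rfl
  | succ k ih =>
    rw [seedUpTo]
    split_ifs with hk
    · have : j ≠ Fin.castLE hmn ⟨k, hk⟩ := by
        intro h'; rw [h'] at h; simp at h; omega
      simp only [Seed.mut, this, if_false]
      exact ih
    · exact ih

theorem x_lt (k : ℕ) (j : Fin n) (h : (j : ℕ) < k) :
    (seedUpTo hmn d S k).x (Fin.castLE hmn j) =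
      (seedUpTo hmn d S ((j : ℕ) + 1)).x (Fin.castLE hmn j) := by
  induction k with
  | zero => omega
  | succ k ih =>
    rcases Nat.lt_succ_iff_lt_or_eq.mp h with h' | h'
    · rw [seedUpTo]
      split_ifs with hk
      · have : Fin.castLE hmn j ≠ Fin.castLE hmn ⟨k, hk⟩ := by
          intro h''
          have := Fin.castLE_injective hmn h''
          subst this; simp at h'
        simp only [Seed.mut, this, if_false]
        exact ih h'
      · exact ih h'
    · subst h'; rfl

theorem rho_ge (k : ℕ) (j : Fin n) (h : k ≤ (j : ℕ)) : (seedUpTo hmn d S k).ρ j = S.ρ j := by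
  induction k with
  | zero => rfl
  | succ k ih =>
    rw [seedUpTo]
    split_ifs with hk
    · have : j ≠ ⟨k, hk⟩ := by
        intro h'; rw [h'] at h; simp at h
      simp only [Seed.mut, this, if_false]
      exact ih (by omega)
    · exact ih (by omega)

end

theorem le_zero_of_ordered {hmn : n ≤ m} {B : Matrix (Fin m) (Fin n) ℤ}
    (hs : SkewSymmetrizable hmn B) (hord : Ordered hmn B) (s t : Fin n) (h : s ≤ t) :
    B (Fin.castLE hmn s) t ≤ 0 := by
  obtain ⟨D, hD, hB⟩ := hs
  have h1 := hB s t
  rcases h.lt_or_eq with h | h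
  · have h2 := hord t s h
    have := hD s
    have := hD t
    by_contra hc
    push Not at hc
    have := mul_pos (hD s) hc
    have := mul_nonneg (hD t).le h2
    linarith
  · subst h
    have : D s * B (Fin.castLE hmn s) s = 0 := by linarith
    rcases mul_eq_zero.mp this with h | h
    · have := hD s; omega
    · exact h.le

theorem ge_zero_of_ordered {hmn : n ≤ m} {B : Matrix (Fin m) (Fin n) ℤ}
    (hs : SkewSymmetrizable hmn B) (hord : Ordered hmn B) (s t : Fin n) (h : t ≤ s) :
    0 ≤ B (Fin.castLE hmn s) t := by
  rcases h.lt_or_eq with h | h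
  · exact hord _ _ h
  · subst h
    obtain ⟨D, hD, hB⟩ := hs
    have h1 := hB t t
    have : D t * B (Fin.castLE hmn t) t = 0 := by linarith
    rcases mul_eq_zero.mp this with h | h
    · have := hD t; omega
    · exact h.ge

theorem B_princ (hmn : n ≤ m) (d : Fin n → ℕ) (S : Seed m n)
    (hs : SkewSymmetrizable hmn S.B) (hord : Ordered hmn S.B) (k : ℕ) (s t : Fin n)
    (h : k ≤ (t : ℕ)) :
    (seedUpTo hmn d S k).B (Fin.castLE hmn s) t =
      if (s : ℕ) < k then -S.B (Fin.castLE hmn s) t else S.B (Fin.castLE hmn s) t := by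
  induction k generalizing s t with
  | zero => simp [seedUpTo]
  | succ k ih =>
    have hk : k < n := by omega
    rw [seedUpTo, dif_pos hk]
    simp only [Seed.mut, matMut]
    have htk : t ≠ ⟨k, hk⟩ := by intro h'; rw [h'] at h; simp at h
    by_cases hsk : s = ⟨k, hk⟩
    · rw [if_pos (Or.inl (by rw [hsk])), ih s t (by omega)]
      subst hsk; simp
    · have hsk' : (s : ℕ) ≠ k := fun h' => hsk (Fin.ext h')
      rw [if_neg, ih s t (by omega), ih s ⟨k, hk⟩ (by simp), ih ⟨k, hk⟩ t (by omega)]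
      · have h1 : S.B (Fin.castLE hmn ⟨k, hk⟩) t ≤ 0 :=
          le_zero_of_ordered hs hord _ _ (by rw [Fin.le_def]; simp; omega)
        have h2 : 0 ≤ (if (s : ℕ) < k then -S.B (Fin.castLE hmn s) ⟨k, hk⟩
            else S.B (Fin.castLE hmn s) ⟨k, hk⟩) := by
          split_ifs with h3
          · have := le_zero_of_ordered hs hord s ⟨k, hk⟩ (by rw [Fin.le_def]; simp; omega)
            omega
          · exact ge_zero_of_ordered hs hord s ⟨k, hk⟩ (by rw [Fin.le_def]; simp; omega)
        simp only [lt_irrefl, if_false]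
        rw [abs_of_nonneg h2, abs_of_nonpos h1]
        have h4 : ((s : ℕ) < k + 1) ↔ ((s : ℕ) < k) := by omega
        simp only [h4]
        have : ∀ a b : ℤ, a * b + a * -b = 0 := fun a b => by ring
        rw [this]; simp
      · rintro (h' | h')
        · exact hsk (Fin.castLE_injective hmn h')
        · exact htk h'

theorem B_frozen (hmn : n ≤ m) (d : Fin n → ℕ) (S : Seed m n)
    (hs : SkewSymmetrizable hmn S.B) (hord : Ordered hmn S.B) (k : ℕ) (j : Fin m) (t : Fin n)
    (hj : n ≤ (j : ℕ)) (h : k ≤ (t : ℕ)) :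
    (seedUpTo hmn d S k).B j t = S.B j t -
      ∑ s ∈ Finset.univ.filter (fun s : Fin n => (s : ℕ) < k ∧ (seedUpTo hmn d S s).B j s < 0),
        S.B (Fin.castLE hmn s) t * (seedUpTo hmn d S s).B j s := by
  classical
  induction k generalizing t with
  | zero => simp [seedUpTo]
  | succ k ih =>
    have hk : k < n := by omega
    have hstep : (seedUpTo hmn d S (k + 1)).B j t = (seedUpTo hmn d S k).B j t -
        if (seedUpTo hmn d S k).B j ⟨k, hk⟩ < 0 then
          S.B (Fin.castLE hmn ⟨k, hk⟩) t * (seedUpTo hmn d S k).B j ⟨k, hk⟩ else 0 := by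
      rw [seedUpTo, dif_pos hk]
      simp only [Seed.mut, matMut]
      have htk : t ≠ ⟨k, hk⟩ := by intro h'; rw [h'] at h; simp at h
      rw [if_neg, B_princ hmn d S hs hord k ⟨k, hk⟩ t (by omega)]
      · have h1 : S.B (Fin.castLE hmn ⟨k, hk⟩) t ≤ 0 :=
          le_zero_of_ordered hs hord _ _ (by rw [Fin.le_def]; simp; omega)
        simp only [lt_irrefl, if_false]
        rw [abs_of_nonpos h1]
        generalize (seedUpTo hmn d S k).B j ⟨k, hk⟩ = c
        generalize S.B (Fin.castLE hmn ⟨k, hk⟩) t = b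
        split_ifs with hc
        · rw [abs_of_neg hc]
          have : -c * b + c * -b = (-(b * c)) * 2 := by ring
          rw [this, Int.mul_ediv_cancel _ (by norm_num)]; ring
        · rw [abs_of_nonneg (by omega)]
          have : c * b + c * -b = 0 := by ring
          rw [this]; simp
      · rintro (h' | h')
        · rw [h'] at hj; simp at hj; omega
        · exact htk h'
    rw [hstep, ih t (by omega)]
    have hset : ∑ s ∈ Finset.univ.filter
        (fun s : Fin n => (s : ℕ) < k + 1 ∧ (seedUpTo hmn d S s).B j s < 0),
        S.B (Fin.castLE hmn s) t * (seedUpTo hmn d S s).B j s =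
        ∑ s ∈ Finset.univ.filter
        (fun s : Fin n => (s : ℕ) < k ∧ (seedUpTo hmn d S s).B j s < 0),
        S.B (Fin.castLE hmn s) t * (seedUpTo hmn d S s).B j s +
        if (seedUpTo hmn d S k).B j ⟨k, hk⟩ < 0 then
          S.B (Fin.castLE hmn ⟨k, hk⟩) t * (seedUpTo hmn d S k).B j ⟨k, hk⟩ else 0 := by
      split_ifs with hc
      · have : Finset.univ.filter
          (fun s : Fin n => (s : ℕ) < k + 1 ∧ (seedUpTo hmn d S s).B j s < 0) =
          insert ⟨k, hk⟩ (Finset.univ.filter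
          (fun s : Fin n => (s : ℕ) < k ∧ (seedUpTo hmn d S s).B j s < 0)) := by
          ext s
          simp only [Finset.mem_filter, Finset.mem_univ, true_and, Finset.mem_insert]
          constructor
          · rintro ⟨h1, h2⟩
            rcases Nat.lt_succ_iff_lt_or_eq.mp h1 with h3 | h3
            · exact Or.inr ⟨h3, h2⟩
            · exact Or.inl (Fin.ext h3)
          · rintro (h1 | h1)
            · subst h1; exact ⟨by simp, hc⟩
            · exact ⟨by omega, h1.2⟩
        rw [this, Finset.sum_insert (by simp), add_comm]
      · rw [add_zero]
        apply Finset.sum_congr _ (fun _ _ => rfl)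
        ext s
        simp only [Finset.mem_filter, Finset.mem_univ, true_and]
        constructor
        · rintro ⟨h1, h2⟩
          rcases Nat.lt_succ_iff_lt_or_eq.mp h1 with h3 | h3
          · exact ⟨h3, h2⟩
          · exfalso
            have : s = ⟨k, hk⟩ := Fin.ext h3
            subst this; exact hc h2
        · rintro ⟨h1, h2⟩; exact ⟨by omega, h2⟩
    rw [hset]; ring

theorem xv_ne_zero (j : Fin m) : xv m j ≠ 0 := by
  unfold xv
  rw [Ne, map_eq_zero_iff _ (IsFractionRing.injective _ _)]
  exact MvPolynomial.X_ne_zero j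

end GCA

namespace GCA

/-- The natural number `|b_{lk}| / d_k`. -/
def gg (hmn : n ≤ m) (d : Fin n → ℕ) (B : Matrix (Fin m) (Fin n) ℤ) (l k : Fin n) : ℕ :=
  (B (Fin.castLE hmn l) k / (d k : ℤ)).natAbs

section
variable {hmn : n ≤ m} {d : Fin n → ℕ} {ρ : Fin n → ℕ → K m} {B : Matrix (Fin m) (Fin n) ℤ}

theorem B_ge (hseed : SeedHyps m n hmn d ρ B) (hord : Ordered hmn B) (l k : Fin n) (h : k ≤ l) :
    B (Fin.castLE hmn l) k = (d k : ℤ) * (gg hmn d B l k : ℤ) := by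
  have h0 := ge_zero_of_ordered hseed.skew hord l k h
  have hd : 0 < (d k : ℤ) := by exact_mod_cast hseed.d_pos k
  unfold gg
  rw [Int.natAbs_of_nonneg (Int.ediv_nonneg h0 hd.le), Int.mul_ediv_cancel' (hseed.d_dvd k l)]

theorem B_le (hseed : SeedHyps m n hmn d ρ B) (hord : Ordered hmn B) (l k : Fin n) (h : l ≤ k) :
    B (Fin.castLE hmn l) k = -((d k : ℤ) * (gg hmn d B l k : ℤ)) := by
  have h0 := le_zero_of_ordered hseed.skew hord l k h
  have hd : 0 < (d k : ℤ) := by exact_mod_cast hseed.d_pos k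
  obtain ⟨c, hc⟩ := hseed.d_dvd k l
  unfold gg
  rw [hc, Int.mul_ediv_cancel_left _ hd.ne']
  have : c ≤ 0 := by
    by_contra h'
    push Not at h'
    have := mul_pos hd h'
    omega
  rw [Int.ofNat_natAbs_of_nonpos this]; ring

theorem exch_step (hseed : SeedHyps m n hmn d ρ B) (hord : Ordered hmn B) (k : Fin n) :
    (seedUpTo hmn d (initSeed m n ρ B) ((k : ℕ) + 1)).x (Fin.castLE hmn k) =
      (xv m (Fin.castLE hmn k))⁻¹ * ∑ r ∈ Finset.range (d k + 1), ρ k r *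
        ((∏ l : Fin n, (seedUpTo hmn d (initSeed m n ρ B) k).x (Fin.castLE hmn l) ^
            (r * gg hmn d B l k)) *
          ∏ j ∈ Finset.univ.filter (fun j : Fin m => n ≤ (j : ℕ)),
            xv m j ^ mutExp (d k) ((seedUpTo hmn d (initSeed m n ρ B) k).B j k) r) := by
  rw [seedUpTo_succ]
  simp only [Seed.mut, if_true, exchangeVar]
  rw [x_ge hmn d _ k _ (by simp), rho_ge hmn d _ k k le_rfl]
  congr 1
  apply Finset.sum_congr rfl
  intro r hr
  have hr' : r ≤ d k := by simp at hr; omega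
  rw [prod_split hmn]
  congr 1
  congr 1
  · apply Finset.prod_congr rfl
    intro l _
    rw [B_princ hmn d _ hseed.skew hord k l k le_rfl]
    have : (if (l : ℕ) < k then -(initSeed m n ρ B).B (Fin.castLE hmn l) k
        else (initSeed m n ρ B).B (Fin.castLE hmn l) k) = (d k : ℤ) * (gg hmn d B l k : ℤ) := by
      split_ifs with h
      · have := B_le hseed hord l k (by rw [Fin.le_def]; omega)
        simp only [initSeed]; rw [this]; ring
      · exact B_ge hseed hord l k (by rw [Fin.le_def]; omega)
    rw [this, mutExp_pos _ _ _ (hseed.d_pos k) hr', zpow_natCast]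
  · apply Finset.prod_congr rfl
    intro j hj
    simp at hj
    rw [x_frozen hmn d _ _ _ hj]; rfl

theorem exch_init (hseed : SeedHyps m n hmn d ρ B) (hord : Ordered hmn B) (i : Fin n) :
    exchangeVar hmn d (initSeed m n ρ B) i =
      (xv m (Fin.castLE hmn i))⁻¹ * ∑ r ∈ Finset.range (d i + 1), ρ i r *
        ((∏ l : Fin n, xv m (Fin.castLE hmn l) ^
            (if l < i then (d i - r) * gg hmn d B l i else r * gg hmn d B l i)) *
          ∏ j ∈ Finset.univ.filter (fun j : Fin m => n ≤ (j : ℕ)),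
            xv m j ^ mutExp (d i) (B j i) r) := by
  simp only [exchangeVar, initSeed]
  congr 1
  apply Finset.sum_congr rfl
  intro r hr
  have hr' : r ≤ d i := by simp at hr; omega
  rw [prod_split hmn]
  congr 2
  apply Finset.prod_congr rfl
  intro l _
  split_ifs with h
  · rw [B_le hseed hord l i h.le, mutExp_neg _ _ _ (hseed.d_pos i) hr', zpow_natCast]
  · rw [B_ge hseed hord l i (not_lt.mp h), mutExp_pos _ _ _ (hseed.d_pos i) hr', zpow_natCast]

theorem gg_pos (hseed : SeedHyps m n hmn d ρ B) (hord : Ordered hmn B) (i k : Fin n) (h : k ≤ i)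
    (hg : gg hmn d B k i ≠ 0) : gg hmn d B i k ≠ 0 := by
  intro h0
  have h1 := B_le hseed hord k i h
  have h2 := B_ge hseed hord i k h
  rw [h0] at h2
  obtain ⟨D, hD, hB⟩ := hseed.skew
  have h3 := hB k i
  rw [h2, h1] at h3
  simp at h3
  rcases h3 with h3 | h3 | h3
  · have := hD k; omega
  · have := hseed.d_pos i; omega
  · exact hg h3

/-- `x_k x_k^{(k)}` is a frozen monomial modulo `x_i`, whenever `b_{ki} ≠ 0`. -/
theorem cg_step (hseed : SeedHyps m n hmn d ρ B) (hord : Ordered hmn B) (i k : Fin n) (h : k < i)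
    (hg : gg hmn d B k i ≠ 0) (R : Subring (K m))
    (hx : ∀ l : Fin n, xv m (Fin.castLE hmn l) ∈ R)
    (hy : ∀ l : Fin n, l < i →
      (seedUpTo hmn d (initSeed m n ρ B) ((l : ℕ) + 1)).x (Fin.castLE hmn l) ∈ R)
    (hf : ∀ j : Fin m, n ≤ (j : ℕ) → ∀ e : ℤ, xv m j ^ e ∈ R)
    (hρ : ∀ (k : Fin n) (r : ℕ), r ≤ d k → ρ k r ∈ R) :
    Cg R (xv m (Fin.castLE hmn i))
      (xv m (Fin.castLE hmn k) *
        (seedUpTo hmn d (initSeed m n ρ B) ((k : ℕ) + 1)).x (Fin.castLE hmn k))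
      (∏ j ∈ Finset.univ.filter (fun j : Fin m => n ≤ (j : ℕ)),
        xv m j ^ max (-(seedUpTo hmn d (initSeed m n ρ B) k).B j k) 0) := by
  have hX : ∀ l : Fin n, (seedUpTo hmn d (initSeed m n ρ B) k).x (Fin.castLE hmn l) ∈ R := by
    intro l
    by_cases hl : l < k
    · rw [x_lt hmn d _ k l hl]; exact hy l (hl.trans h)
    · rw [x_ge hmn d _ k _ (by simp; exact not_lt.mp hl)]; exact hx l
  rw [exch_step hseed hord k, ← mul_assoc, mul_inv_cancel₀ (xv_ne_zero _), one_mul,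
    Finset.sum_range_succ', ← zero_add (∏ j ∈ _, xv m j ^ max _ _)]
  have hFr : ∀ e : Fin m → ℤ, ∏ j ∈ Finset.univ.filter (fun j : Fin m => n ≤ (j : ℕ)),
      xv m j ^ e j ∈ R := by
    intro e
    apply R.prod_mem
    intro j hj
    exact hf j (by simpa using hj) _
  apply Cg.add
  · rw [← Finset.sum_const_zero (s := Finset.range (d k))]
    apply Cg.sum
    intro r hr
    have hr' : r + 1 ≤ d k := by simp at hr; omega
    have hxi : (seedUpTo hmn d (initSeed m n ρ B) k).x (Fin.castLE hmn i) =
        xv m (Fin.castLE hmn i) := x_ge hmn d _ k _ (by simp; exact h.le)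
    obtain ⟨q, hq⟩ : ∃ q, (r + 1) * gg hmn d B i k = q + 1 :=
      Nat.exists_eq_succ_of_ne_zero (mul_ne_zero (by omega) (gg_pos hseed hord i k h.le hg))
    refine ⟨R.mul_mem (hρ _ _ hr') (R.mul_mem (R.prod_mem fun l _ => R.pow_mem (hX l) _) (hFr _)),
      R.zero_mem, ρ k (r + 1) * ((xv m (Fin.castLE hmn i) ^ q * ∏ l ∈ Finset.univ.erase i,
        (seedUpTo hmn d (initSeed m n ρ B) k).x (Fin.castLE hmn l) ^
            ((r + 1) * gg hmn d B l k)) *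
          ∏ j ∈ Finset.univ.filter (fun j : Fin m => n ≤ (j : ℕ)),
            xv m j ^ mutExp (d k) ((seedUpTo hmn d (initSeed m n ρ B) k).B j k) (r + 1)),
      R.mul_mem (hρ _ _ hr') (R.mul_mem (R.mul_mem (R.pow_mem (hx i) _)
        (R.prod_mem fun l _ => R.pow_mem (hX l) _)) (hFr _)), ?_⟩
    rw [← Finset.mul_prod_erase Finset.univ _ (Finset.mem_univ i), hq, hxi]
    ring
  · have : ∀ j, mutExp (d k) ((seedUpTo hmn d (initSeed m n ρ B) k).B j k) 0 =
        max (-(seedUpTo hmn d (initSeed m n ρ B) k).B j k) 0 := fun j =>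
      mutExp_zero_right _ _ (hseed.d_pos k)
    simp only [this, hseed.rho_zero, one_mul, zero_mul, pow_zero, Finset.prod_const_one]
    exact Cg.refl (hFr _)

/-- The frozen monomials match. -/
theorem frozen_match (hseed : SeedHyps m n hmn d ρ B) (hord : Ordered hmn B) (i : Fin n)
    (r : ℕ) (hr : r ≤ d i) :
    (∏ l ∈ Finset.univ.filter (fun l : Fin n => l < i),
      (∏ j ∈ Finset.univ.filter (fun j : Fin m => n ≤ (j : ℕ)),
        xv m j ^ max (-(seedUpTo hmn d (initSeed m n ρ B) l).B j l) 0) ^ (r * gg hmn d B l i)) *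
      (∏ j ∈ Finset.univ.filter (fun j : Fin m => n ≤ (j : ℕ)),
        xv m j ^ mutExp (d i) ((seedUpTo hmn d (initSeed m n ρ B) i).B j i) r) =
    (∏ j ∈ Finset.univ.filter (fun j : Fin m => n ≤ (j : ℕ)), xv m j ^ mutExp (d i) (B j i) r) *
      (∏ j ∈ Finset.univ.filter (fun j : Fin m =>
                n ≤ (j : ℕ) ∧ (seedUpTo hmn d (initSeed m n ρ B) (i : ℕ)).B j i < 0),
              (xv m j ^ (-(max (B j i) 0)) *
                ∏ k ∈ Finset.univ.filter (fun k : Fin n =>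
                    k < i ∧ (seedUpTo hmn d (initSeed m n ρ B) (k : ℕ)).B j k < 0),
                  xv m j ^
                    ((seedUpTo hmn d (initSeed m n ρ B) (k : ℕ)).B (Fin.castLE hmn k) i *
                      (seedUpTo hmn d (initSeed m n ρ B) (k : ℕ)).B j k))) := by
  classical
  simp only [← Finset.prod_pow]
  rw [Finset.prod_comm, ← Finset.prod_mul_distrib, ← Finset.filter_filter,
    Finset.prod_filter (fun j : Fin m => (seedUpTo hmn d (initSeed m n ρ B) (i : ℕ)).B j i < 0),
    ← Finset.prod_mul_distrib]
  apply Finset.prod_congr rfl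
  intro j hj
  have hj' : n ≤ (j : ℕ) := by simpa using hj
  have hne := xv_ne_zero j
  have hz : ∀ (s : Finset (Fin n)) (e : Fin n → ℤ),
      ∏ l ∈ s, xv m j ^ e l = xv m j ^ (∑ l ∈ s, e l) := by
    intro s e
    induction s using Finset.induction_on with
    | empty => simp
    | insert a s ha ih => rw [Finset.prod_insert ha, Finset.sum_insert ha, ih, zpow_add₀ hne]
  set e : ℤ := ∑ l ∈ Finset.univ.filter (fun l : Fin n => l < i),
    (gg hmn d B l i : ℤ) * max (-(seedUpTo hmn d (initSeed m n ρ B) l).B j l) 0 with he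
  have he0 : 0 ≤ e := Finset.sum_nonneg fun l _ => mul_nonneg (by positivity) (le_max_right _ _)
  have hde : (d i : ℤ) * e = ∑ k ∈ Finset.univ.filter (fun k : Fin n =>
      k < i ∧ (seedUpTo hmn d (initSeed m n ρ B) (k : ℕ)).B j k < 0),
        B (Fin.castLE hmn k) i * (seedUpTo hmn d (initSeed m n ρ B) (k : ℕ)).B j k := by
    rw [he, Finset.mul_sum, ← Finset.filter_filter, Finset.sum_filter
      (fun k : Fin n => (seedUpTo hmn d (initSeed m n ρ B) (k : ℕ)).B j k < 0)]
    apply Finset.sum_congr rfl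
    intro k hk
    have hk' : k < i := by simpa using hk
    rw [B_le hseed hord k i hk'.le]
    split_ifs with hc
    · rw [max_eq_left (by omega)]; ring
    · rw [max_eq_right (by omega)]; ring
  have hc : (seedUpTo hmn d (initSeed m n ρ B) i).B j i = B j i - d i * e := by
    rw [B_frozen hmn d _ hseed.skew hord i j i hj' le_rfl, hde]
    rfl
  have hP : ∏ l ∈ Finset.univ.filter (fun l : Fin n => l < i),
      (xv m j ^ max (-(seedUpTo hmn d (initSeed m n ρ B) l).B j l) 0) ^ (r * gg hmn d B l i) =
      xv m j ^ ((r : ℤ) * e) := by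
    rw [he, Finset.mul_sum, ← hz]
    apply Finset.prod_congr rfl
    intro l _
    rw [← zpow_natCast, ← zpow_mul]
    congr 1
    push_cast; ring
  have hQ : ∏ k ∈ Finset.univ.filter (fun k : Fin n =>
      k < i ∧ (seedUpTo hmn d (initSeed m n ρ B) (k : ℕ)).B j k < 0),
      xv m j ^ ((seedUpTo hmn d (initSeed m n ρ B) (k : ℕ)).B (Fin.castLE hmn k) i *
        (seedUpTo hmn d (initSeed m n ρ B) (k : ℕ)).B j k) = xv m j ^ ((d i : ℤ) * e) := by
    rw [hde, ← hz]
    apply Finset.prod_congr rfl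
    intro k hk
    simp only [Finset.mem_filter, Finset.mem_univ, true_and] at hk
    rw [B_princ hmn d _ hseed.skew hord k k i (by exact hk.1.le)]
    simp [initSeed]
  rw [hP, hQ, hc, ← zpow_add₀ hne, ← zpow_add₀ hne, add_comm,
    mutExp_shift _ _ _ _ (hseed.d_pos i) he0 hr, zpow_add₀ hne]
  split_ifs <;> simp

end
end GCA

open GCA in
/-- For an acyclic ordered generalized seed and `i ∈ [1,n]`:
`∏_{k=1}^{i−1} x_k^{−b_{ki}} · x_i^{(i)} =
 x'_i · ∏_{j frozen, b^{(i−1)}_{ji}<0} ( x_j^{−[b_{ji}]₊} ∏_{k<i, b^{(k−1)}_{jk}<0}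
 x_j^{b^{(k−1)}_{ki} b^{(k−1)}_{jk}} ) + f`
for some `f ∈ ℤℙ[x₁, …, x_n, x₁^{(1)}, …, x_{i−1}^{(i−1)}]`. -/
theorem projStep_key_identity {m n : ℕ} (hn : 1 ≤ n) (hmn : n ≤ m)
    (d : Fin n → ℕ) (ρ : Fin n → ℕ → K m) (B : Matrix (Fin m) (Fin n) ℤ)
    (hseed : SeedHyps m n hmn d ρ B)
    (hacyc : Acyclic hmn B) (hord : Ordered hmn B) (i : Fin n) :
    ∃ f ∈ Algebra.adjoin (↥(ZP m n))
        ({y | ∃ j : Fin n, y = xv m (Fin.castLE hmn j)} ∪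
          {y | ∃ j : Fin n, j < i ∧
            y = (seedUpTo hmn d (initSeed m n ρ B) ((j : ℕ) + 1)).x (Fin.castLE hmn j)}),
      (∏ k ∈ Finset.univ.filter (fun k : Fin n => k < i),
          xv m (Fin.castLE hmn k) ^ (-B (Fin.castLE hmn k) i)) *
          (seedUpTo hmn d (initSeed m n ρ B) ((i : ℕ) + 1)).x (Fin.castLE hmn i) =
        exchangeVar hmn d (initSeed m n ρ B) i *
            (∏ j ∈ Finset.univ.filter (fun j : Fin m =>
                n ≤ (j : ℕ) ∧ (seedUpTo hmn d (initSeed m n ρ B) (i : ℕ)).B j i < 0),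
              (xv m j ^ (-(max (B j i) 0)) *
                ∏ k ∈ Finset.univ.filter (fun k : Fin n =>
                    k < i ∧ (seedUpTo hmn d (initSeed m n ρ B) (k : ℕ)).B j k < 0),
                  xv m j ^
                    ((seedUpTo hmn d (initSeed m n ρ B) (k : ℕ)).B (Fin.castLE hmn k) i *
                      (seedUpTo hmn d (initSeed m n ρ B) (k : ℕ)).B j k))) +
          f := by
  classical
  set A := Algebra.adjoin (↥(ZP m n))
        ({y | ∃ j : Fin n, y = xv m (Fin.castLE hmn j)} ∪
          {y | ∃ j : Fin n, j < i ∧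
            y = (seedUpTo hmn d (initSeed m n ρ B) ((j : ℕ) + 1)).x (Fin.castLE hmn j)}) with hA
  set R : Subring (K m) := A.toSubring with hR
  have hZ : ∀ z ∈ ZP m n, z ∈ R := fun z hz => A.algebraMap_mem ⟨z, hz⟩
  have hx : ∀ l : Fin n, xv m (Fin.castLE hmn l) ∈ R := fun l =>
    Algebra.subset_adjoin (Or.inl ⟨l, rfl⟩)
  have hy : ∀ l : Fin n, l < i →
      (seedUpTo hmn d (initSeed m n ρ B) ((l : ℕ) + 1)).x (Fin.castLE hmn l) ∈ R := fun l hl =>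
    Algebra.subset_adjoin (Or.inr ⟨l, hl, rfl⟩)
  have hf : ∀ j : Fin m, n ≤ (j : ℕ) → ∀ e : ℤ, xv m j ^ e ∈ R := by
    intro j hj e
    apply hZ
    have h1 : xv m j ∈ ZP m n := Algebra.subset_adjoin ⟨j, hj, Or.inl rfl⟩
    have h2 : (xv m j)⁻¹ ∈ ZP m n := Algebra.subset_adjoin ⟨j, hj, Or.inr rfl⟩
    rcases Int.eq_nat_or_neg e with ⟨k, rfl | rfl⟩
    · rw [zpow_natCast]; exact (ZP m n).pow_mem h1 _
    · rw [zpow_neg, zpow_natCast, ← inv_pow]; exact (ZP m n).pow_mem h2 _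
  have hρ : ∀ (k : Fin n) (r : ℕ), r ≤ d k → ρ k r ∈ R := by
    intro k r hr
    obtain ⟨c, e, he, hp⟩ := hseed.rho_mon k r hr
    rw [hp]
    refine R.mul_mem (intCast_mem R c) (R.prod_mem fun j _ => ?_)
    by_cases hj : (j : ℕ) < n
    · rw [he j hj, pow_zero]; exact R.one_mem
    · rw [← zpow_natCast]; exact hf j (not_lt.mp hj) _
  have hFr : ∀ e : Fin m → ℤ, ∏ j ∈ Finset.univ.filter (fun j : Fin m => n ≤ (j : ℕ)),
      xv m j ^ e j ∈ R := by
    intro e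
    apply R.prod_mem
    intro j hj
    exact hf j (by simpa using hj) _
  have hxi := xv_ne_zero (Fin.castLE hmn i)
  set M : Fin n → K m := fun l => ∏ j ∈ Finset.univ.filter (fun j : Fin m => n ≤ (j : ℕ)),
        xv m j ^ max (-(seedUpTo hmn d (initSeed m n ρ B) l).B j l) 0 with hM
  -- termwise congruence
  have key : ∀ r ∈ Finset.range (d i + 1), Cg R (xv m (Fin.castLE hmn i))
      ((∏ k ∈ Finset.univ.filter (fun k : Fin n => k < i),
          xv m (Fin.castLE hmn k) ^ (-B (Fin.castLE hmn k) i)) * (ρ i r *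
        ((∏ l : Fin n, (seedUpTo hmn d (initSeed m n ρ B) i).x (Fin.castLE hmn l) ^
            (r * gg hmn d B l i)) *
          ∏ j ∈ Finset.univ.filter (fun j : Fin m => n ≤ (j : ℕ)),
            xv m j ^ mutExp (d i) ((seedUpTo hmn d (initSeed m n ρ B) i).B j i) r)))
      (ρ i r * ((∏ l : Fin n, xv m (Fin.castLE hmn l) ^
            (if l < i then (d i - r) * gg hmn d B l i else r * gg hmn d B l i)) *
          ((∏ l ∈ Finset.univ.filter (fun l : Fin n => l < i), M l ^ (r * gg hmn d B l i)) *
          ∏ j ∈ Finset.univ.filter (fun j : Fin m => n ≤ (j : ℕ)),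
            xv m j ^ mutExp (d i) ((seedUpTo hmn d (initSeed m n ρ B) i).B j i) r))) := by
    intro r hr
    have hr' : r ≤ d i := by simp at hr; omega
    rw [mul_left_comm, ← mul_assoc (∏ k ∈ _, _), ← mul_assoc (∏ l : Fin n, _),
      Finset.prod_filter (fun k : Fin n => k < i), Finset.prod_filter (fun k : Fin n => k < i),
      ← Finset.prod_mul_distrib,
      ← Finset.prod_mul_distrib]
    refine (Cg.refl (hρ i r hr')).mul (Cg.mul (Cg.prod _ _ _ ?_) (Cg.refl (hFr _)))
    intro l _
    by_cases hl : l < i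
    · rw [if_pos hl, if_pos hl, if_pos hl, x_lt hmn d _ i l hl, B_le hseed hord l i hl.le, neg_neg]
      by_cases hg : gg hmn d B l i = 0
      · simpa [hg] using Cg.refl R.one_mem
      · have h1 := (cg_step hseed hord i l hl hg R hx hy hf hρ).pow (r * gg hmn d B l i)
        have h2 := (Cg.refl (R := R) (x := xv m (Fin.castLE hmn i))
          (R.pow_mem (hx l) ((d i - r) * gg hmn d B l i))).mul h1
        convert h2 using 1
        rw [mul_pow, ← mul_assoc, ← pow_add, ← add_mul, Nat.sub_add_cancel hr']
        congr 1
    · rw [if_neg hl, if_neg hl, if_neg hl, one_mul, mul_one,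
        x_ge hmn d _ i _ (by simp; exact not_lt.mp hl)]
      exact Cg.refl (R.pow_mem (hx l) _)
  obtain ⟨-, -, z, hz, hzeq⟩ := Cg.sum _ _ _ key
  refine ⟨z, hz, ?_⟩
  rw [exch_step hseed hord i, exch_init hseed hord i, mul_left_comm, Finset.mul_sum,
    sub_eq_iff_eq_add.mp hzeq, mul_add, ← mul_assoc _ _ z, inv_mul_cancel₀ hxi, one_mul,
    add_comm z, mul_assoc, Finset.sum_mul]
  congr 2
  apply Finset.sum_congr rfl
  intro r hr
  have hr' : r ≤ d i := by simp at hr; omega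
  rw [hM, frozen_match hseed hord i r hr']
  ring
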